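/- arXiv:1205.3841 — 2 statements merged into one kernel-verified Lean document; each statement's English description precedes it below -/
import Mathlib

section
/- Suppose a_{il} < 0 for every l ≠ i. Then for every x ∈ S^{m-1} with x_i < 1 one has lim_{k→∞} (V^k x)_i = 0. -/
/-- The Volterra quadratic stochastic operator associated with
a skew-symmetric matrix `A`. -/
noncomputable def volterraOp {m : ℕ} (A : Matrix (Fin m) (Fin m) ℝ)
    (x : Fin m → ℝ) : Fin m → ℝ :=
  fun k => x k * (1 + ∑ i, A k i * x i)

open Finset in
/-- The skew-symmetric quadratic form vanishes, so `volterraOp A` preserves the coordinate sum. -/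
theorem sum_volterraOp {m : ℕ} {A : Matrix (Fin m) (Fin m) ℝ}
    (hskew : ∀ i j, A j i = -A i j) (x : Fin m → ℝ) :
    ∑ k, volterraOp A x k = ∑ k, x k := by
  have h : ∑ k, ∑ j, x k * (A k j * x j) = -∑ k, ∑ j, x k * (A k j * x j) := by
    conv_lhs => rw [sum_comm]
    simp only [← sum_neg_distrib]
    refine sum_congr rfl fun k _ => sum_congr rfl fun j _ => ?_
    rw [hskew k j]
    ring
  simp only [volterraOp, mul_add, mul_one, sum_add_distrib, mul_sum]
  linarith

theorem volterraOp_mem_stdSimplex {m : ℕ} {A : Matrix (Fin m) (Fin m) ℝ}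
    (hskew : ∀ i j, A j i = -A i j) (hbd : ∀ i j, |A i j| ≤ 1)
    {x : Fin m → ℝ} (hx : x ∈ stdSimplex ℝ (Fin m)) :
    volterraOp A x ∈ stdSimplex ℝ (Fin m) := by
  refine ⟨fun k => mul_nonneg (hx.1 k) ?_, (sum_volterraOp hskew x).trans hx.2⟩
  have h : ∑ j, -x j ≤ ∑ j, A k j * x j := by
    refine Finset.sum_le_sum fun j _ => ?_
    nlinarith [hx.1 j, (abs_le.1 (hbd k j)).1]
  rw [Finset.sum_neg_distrib, hx.2] at h
  linarith

theorem volterraOp_apply_le {m : ℕ} {A : Matrix (Fin m) (Fin m) ℝ} {i : Fin m} {ε : ℝ}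
    (hdiag : A i i = 0) (hrow : ∀ l, l ≠ i → A i l ≤ -ε)
    {x : Fin m → ℝ} (hx : x ∈ stdSimplex ℝ (Fin m)) :
    volterraOp A x i ≤ x i * (1 - ε * (1 - x i)) := by
  refine mul_le_mul_of_nonneg_left ?_ (hx.1 i)
  have h : ∑ j, A i j * x j ≤ ∑ j, (-ε * x j + if j = i then ε * x i else 0) := by
    refine Finset.sum_le_sum fun j _ => ?_
    by_cases hj : j = i
    · subst hj
      simp [hdiag]
    · simpa [hj] using mul_le_mul_of_nonneg_right (hrow j hj) (hx.1 j)
  rw [Finset.sum_add_distrib, ← Finset.mul_sum, hx.2] at h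
  simp only [Finset.sum_ite_eq', Finset.mem_univ, if_true] at h
  linarith

theorem exists_uniform_neg_bound {m : ℕ} {f : Fin m → ℝ} {i : Fin m}
    (hf : ∀ l, l ≠ i → f l < 0) :
    ∃ ε : ℝ, 0 < ε ∧ ε ≤ 1 ∧ ∀ l, l ≠ i → f l ≤ -ε := by
  obtain ⟨b, -, hb⟩ := Finset.exists_max_image Finset.univ
    (fun l => if l = i then -1 else f l) ⟨i, Finset.mem_univ i⟩
  refine ⟨-(if b = i then -1 else f b), ?_, ?_, fun l hl => ?_⟩
  · split_ifs with h
    · norm_num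
    · exact neg_pos.2 (hf b h)
  · have := hb i (Finset.mem_univ i)
    rw [if_pos rfl] at this
    linarith
  · have := hb l (Finset.mem_univ l)
    rw [if_neg hl] at this
    linarith

/-- If `a_{il} < 0` for all `l ≠ i`, then for every simplex point
with `x_i < 1` one has `(V^k x)_i → 0`. -/
theorem stmt_6 {m : ℕ} (A : Matrix (Fin m) (Fin m) ℝ)
    (hskew : ∀ i j, A j i = -A i j) (hbd : ∀ i j, |A i j| ≤ 1)
    (i : Fin m) (hrow : ∀ l, l ≠ i → A i l < 0)
    (x : Fin m → ℝ) (hx : ∀ j, 0 ≤ x j) (hxsum : ∑ j, x j = 1)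
    (hxi : x i < 1) :
    Filter.Tendsto (fun k : ℕ => (volterraOp A)^[k] x i)
      Filter.atTop (nhds 0) := by
  obtain ⟨ε, hε, hε1, hrow'⟩ := exists_uniform_neg_bound hrow
  have hdiag : A i i = 0 := by linarith [hskew i i]
  have hmem (k : ℕ) : (volterraOp A)^[k] x ∈ stdSimplex ℝ (Fin m) := by
    induction k with
    | zero => exact ⟨hx, hxsum⟩
    | succ k ih =>
      rw [Function.iterate_succ_apply']
      exact volterraOp_mem_stdSimplex hskew hbd ih
  set r := 1 - ε * (1 - x i) with hr
  have hr0 : 0 ≤ r := by nlinarith [hx i]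
  have hr1 : r < 1 := by nlinarith
  have hle (k : ℕ) : (volterraOp A)^[k] x i ≤ r ^ k * x i := by
    induction k with
    | zero => simp
    | succ k ih =>
      have hk : (volterraOp A)^[k] x i ≤ x i :=
        ih.trans (mul_le_of_le_one_left (hx i) (pow_le_one₀ hr0 hr1.le))
      have hfac : 1 - ε * (1 - (volterraOp A)^[k] x i) ≤ r := by
        rw [hr]
        gcongr
      rw [Function.iterate_succ_apply']
      calc volterraOp A ((volterraOp A)^[k] x) i
          ≤ (volterraOp A)^[k] x i * (1 - ε * (1 - (volterraOp A)^[k] x i)) :=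
            volterraOp_apply_le hdiag hrow' (hmem k)
        _ ≤ (volterraOp A)^[k] x i * r := mul_le_mul_of_nonneg_left hfac ((hmem k).1 i)
        _ ≤ r ^ k * x i * r := mul_le_mul_of_nonneg_right ih hr0
        _ = r ^ (k + 1) * x i := by ring
  refine squeeze_zero (fun k => (hmem k).1 i) hle ?_
  simpa using (tendsto_pow_atTop_nhds_zero_of_lt_one hr0 hr1).mul_const (x i)
end

section
/- Let x be a point in the interior of S³ (all coordinates positive). Assume that lim_{n→∞} min{(Vⁿx)₁, (Vⁿx)₃, (Vⁿx)₄} = 0 and that neither of the two face fixed points p = (a₃₄, 0, a₁₄, a₁₃)/(a₃₄+a₁₄+a₁₃) and q = (a₂₄, a₁₄, 0, a₁₂)/(a₂₄+a₁₄+a₁₂) belongs to ω(x). Then ω(x) ⊆ {y ∈ S³ : y₁y₂y₄ = 0 and y₁y₃y₄ = 0}; equivalently, ω(x) is contained in the union of the faces {y₄ = 0}, {y₁ = 0} and the edge {y₂ = y₃ = 0}. -/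
/-- The three-dimensional simplex `S³ ⊆ ℝ⁴`. -/
def simplex3 : Set (Fin 4 → ℝ) := {x | (∀ i, 0 ≤ x i) ∧ ∑ i, x i = 1}

/-- The Volterra operator `(Vx)_k = x_k (1 + (Ax)_k)` associated with the canonical
third-class skew-symmetric matrix with rows `(0, a12, a13, -a14)`, `(-a12, 0, a23, a24)`,
`(-a13, -a23, 0, a34)`, `(a14, -a24, -a34, 0)`. -/
noncomputable def volterra3 (a12 a13 a14 a23 a24 a34 : ℝ)
    (x : Fin 4 → ℝ) : Fin 4 → ℝ :=
  ![x 0 * (1 + (a12 * x 1 + a13 * x 2 + -a14 * x 3)),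
    x 1 * (1 + (-a12 * x 0 + a23 * x 2 + a24 * x 3)),
    x 2 * (1 + (-a13 * x 0 + -a23 * x 1 + a34 * x 3)),
    x 3 * (1 + (a14 * x 0 + -a24 * x 1 + -a34 * x 2))]

/-- The ω-limit set of `x` under `V`: points `y` for which some subsequence
`V^{n_k} x` (with `n_k → ∞`) converges to `y`. -/
def omegaSet (V : (Fin 4 → ℝ) → (Fin 4 → ℝ)) (x : Fin 4 → ℝ) : Set (Fin 4 → ℝ) :=
  {y | ∃ n : ℕ → ℕ, Filter.Tendsto n Filter.atTop Filter.atTop ∧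
    Filter.Tendsto (fun k => V^[n k] x) Filter.atTop (nhds y)}

open Filter Topology

section OmegaSet

variable {V : (Fin 4 → ℝ) → (Fin 4 → ℝ)} {x : Fin 4 → ℝ}

theorem mem_omegaSet_iff_mapClusterPt {y : Fin 4 → ℝ} :
    y ∈ omegaSet V x ↔ MapClusterPt y atTop (fun n => V^[n] x) := by
  constructor
  · rintro ⟨n, hn, hy⟩
    exact MapClusterPt.of_comp hn hy.mapClusterPt
  · intro h
    obtain ⟨ψ, hψ, hy⟩ := h.tendsto_subseq
    exact ⟨ψ, hψ.tendsto_atTop, hy⟩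

theorem isClosed_omegaSet : IsClosed (omegaSet V x) := by
  have h : omegaSet V x = {y | ClusterPt y (map (fun n => V^[n] x) atTop)} :=
    Set.ext fun _ => mem_omegaSet_iff_mapClusterPt
  rw [h]
  exact isClosed_setOfPred_clusterPt

theorem omegaSet_subset {K : Set (Fin 4 → ℝ)} (hK : IsClosed K) (hVK : ∀ n, V^[n] x ∈ K) :
    omegaSet V x ⊆ K := by
  rintro y ⟨n, -, hy⟩
  exact hK.mem_of_tendsto hy (Eventually.of_forall fun k => hVK (n k))

/-- The map is surjective on the `ω`-limit set of a relatively compact orbit. -/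
theorem exists_preimage_mem_omegaSet {K : Set (Fin 4 → ℝ)} (hV : Continuous V)
    (hK : IsCompact K) (hVK : ∀ n, V^[n] x ∈ K) {y : Fin 4 → ℝ} (hy : y ∈ omegaSet V x) :
    ∃ w ∈ omegaSet V x, V w = y := by
  obtain ⟨n, hn, hy⟩ := hy
  obtain ⟨w, -, ψ, hψ, hw⟩ := hK.tendsto_subseq fun k => hVK (n k - 1)
  have hnψ : Tendsto (n ∘ ψ) atTop atTop := hn.comp hψ.tendsto_atTop
  refine ⟨w, ⟨fun k => n (ψ k) - 1, (tendsto_sub_atTop_nat 1).comp hnψ, hw⟩, ?_⟩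
  refine tendsto_nhds_unique ((hV.tendsto w).comp hw)
    ((hy.comp hψ.tendsto_atTop).congr' ?_)
  filter_upwards [hnψ.eventually_ge_atTop 1] with k hk
  have hk' : n (ψ k) = (n (ψ k) - 1) + 1 := by
    simp only [Function.comp_apply] at hk
    omega
  simp only [Function.comp_apply]
  conv_lhs => rw [hk', Function.iterate_succ_apply']

end OmegaSet

theorem isCompact_simplex3 : IsCompact simplex3 :=
  isCompact_stdSimplex ℝ (Fin 4)

theorem continuous_volterra3 (a12 a13 a14 a23 a24 a34 : ℝ) :
    Continuous (volterra3 a12 a13 a14 a23 a24 a34) := by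
  refine continuous_pi fun i => ?_
  fin_cases i <;> simp [volterra3] <;> fun_prop

theorem volterra3_mem_simplex3 {a12 a13 a14 a23 a24 a34 : ℝ}
    (h12 : a12 ∈ Set.Ioo (0 : ℝ) 1) (h13 : a13 ∈ Set.Ioo (0 : ℝ) 1)
    (h14 : a14 ∈ Set.Ioo (0 : ℝ) 1) (h23 : a23 ∈ Set.Ioo (0 : ℝ) 1)
    (h24 : a24 ∈ Set.Ioo (0 : ℝ) 1) (h34 : a34 ∈ Set.Ioo (0 : ℝ) 1)
    {x : Fin 4 → ℝ} (hx : x ∈ simplex3) :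
    volterra3 a12 a13 a14 a23 a24 a34 x ∈ simplex3 := by
  obtain ⟨hx, hsum⟩ := hx
  rw [Fin.sum_univ_four] at hsum
  have hb : ∀ {a : ℝ}, a ∈ Set.Ioo (0 : ℝ) 1 → ∀ i, 0 ≤ a * x i ∧ a * x i ≤ x i :=
    fun ha i => ⟨mul_nonneg ha.1.le (hx i), mul_le_of_le_one_left (hx i) ha.2.le⟩
  have x0 := hx 0
  have x1 := hx 1
  have x2 := hx 2
  have x3 := hx 3
  refine ⟨fun i => ?_, ?_⟩
  · fin_cases i
    · exact mul_nonneg x0 (by linarith [hb h12 1, hb h13 2, hb h14 3])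
    · exact mul_nonneg x1 (by linarith [hb h12 0, hb h23 2, hb h24 3])
    · exact mul_nonneg x2 (by linarith [hb h13 0, hb h23 1, hb h34 3])
    · exact mul_nonneg x3 (by linarith [hb h14 0, hb h24 1, hb h34 2])
  · simp only [Fin.sum_univ_four, volterra3, Matrix.cons_val]
    linear_combination hsum

/-- A weighted sum of logarithms of positive numbers whose weighted mean is `1` is negative
unless all of these numbers are `1`. -/
theorem weighted_log_sum_neg {a b c r s t : ℝ} (ha : 0 < a) (hb : 0 < b) (hc : 0 < c)
    (hr : 0 < r) (hs : 0 < s) (ht : 0 < t)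
    (hmean : a * (r - 1) + b * (s - 1) + c * (t - 1) = 0) (hne : ¬(r = 1 ∧ s = 1 ∧ t = 1)) :
    a * Real.log r + b * Real.log s + c * Real.log t < 0 := by
  have hle : ∀ {d u : ℝ}, 0 < d → 0 < u → d * Real.log u ≤ d * (u - 1) := fun hd hu =>
    mul_le_mul_of_nonneg_left (Real.log_le_sub_one_of_pos hu) hd.le
  have hlt : ∀ {d u : ℝ}, 0 < d → 0 < u → u ≠ 1 → d * Real.log u < d * (u - 1) :=
    fun hd hu h => mul_lt_mul_of_pos_left (Real.log_lt_sub_one_of_pos hu h) hd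
  by_cases h1 : r = 1
  · by_cases h2 : s = 1
    · have h3 : t ≠ 1 := fun h3 => hne ⟨h1, h2, h3⟩
      linarith [hle ha hr, hle hb hs, hlt hc ht h3]
    · linarith [hle ha hr, hlt hb hs h2, hle hc ht]
  · linarith [hlt ha hr h1, hle hb hs, hle hc ht]

/-- The Lyapunov function `z₁^a z₂^b z₄^c` of the face `z₃ = 0`. -/
noncomputable def faceLyapunov (a b c : ℝ) (z : Fin 4 → ℝ) : ℝ :=
  z 0 ^ a * z 1 ^ b * z 3 ^ c

theorem continuous_faceLyapunov {a b c : ℝ} (ha : 0 < a) (hb : 0 < b) (hc : 0 < c) :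
    Continuous (faceLyapunov a b c) :=
  (((continuous_apply 0).rpow_const fun _ => Or.inr ha.le).mul
    ((continuous_apply 1).rpow_const fun _ => Or.inr hb.le)).mul
    ((continuous_apply 3).rpow_const fun _ => Or.inr hc.le)

theorem pos_of_faceLyapunov_pos {a b c : ℝ} (ha : 0 < a) (hb : 0 < b) (hc : 0 < c)
    {z : Fin 4 → ℝ} (hz : ∀ i, 0 ≤ z i) (h : 0 < faceLyapunov a b c z) :
    0 < z 0 ∧ 0 < z 1 ∧ 0 < z 3 := by
  refine ⟨(hz 0).lt_of_ne' fun h0 => ?_, (hz 1).lt_of_ne' fun h0 => ?_,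
    (hz 3).lt_of_ne' fun h0 => ?_⟩ <;>
  simp [faceLyapunov, h0, Real.zero_rpow, ha.ne', hb.ne', hc.ne'] at h

theorem faceLyapunov_pos {a b c : ℝ} {z : Fin 4 → ℝ}
    (h0 : 0 < z 0) (h1 : 0 < z 1) (h3 : 0 < z 3) : 0 < faceLyapunov a b c z := by
  unfold faceLyapunov
  positivity

theorem log_faceLyapunov {a b c : ℝ} {z : Fin 4 → ℝ}
    (h0 : 0 < z 0) (h1 : 0 < z 1) (h3 : 0 < z 3) :
    Real.log (faceLyapunov a b c z) =
      a * Real.log (z 0) + b * Real.log (z 1) + c * Real.log (z 3) := by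
  unfold faceLyapunov
  rw [Real.log_mul (by positivity) (by positivity), Real.log_mul (by positivity) (by positivity),
    Real.log_rpow h0, Real.log_rpow h1, Real.log_rpow h3]

/-- A point of the simplex whose image lies in the relative interior of the face `z₃ = 0` lies
there itself, and unless it is the fixed point `q` of that face, the Lyapunov function strictly
decreases there. -/
theorem faceLyapunov_volterra3_lt {a12 a13 a14 a23 a24 a34 : ℝ}
    (h12 : 0 < a12) (h13 : a13 < 1) (h14 : 0 < a14) (h23 : a23 < 1) (h24 : 0 < a24) (h34 : 0 < a34)
    {w : Fin 4 → ℝ} (hw : w ∈ simplex3)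
    (hwq : w ≠ fun i => ![a24, a14, 0, a12] i / (a24 + a14 + a12))
    (h2 : volterra3 a12 a13 a14 a23 a24 a34 w 2 = 0)
    (hpos : 0 < faceLyapunov a24 a14 a12 (volterra3 a12 a13 a14 a23 a24 a34 w))
    (hnonneg : ∀ i, 0 ≤ volterra3 a12 a13 a14 a23 a24 a34 w i) :
    w 2 = 0 ∧ faceLyapunov a24 a14 a12 (volterra3 a12 a13 a14 a23 a24 a34 w) <
      faceLyapunov a24 a14 a12 w := by
  obtain ⟨hw, hsum⟩ := hw
  rw [Fin.sum_univ_four] at hsum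
  obtain ⟨v0, v1, v3⟩ := pos_of_faceLyapunov_pos h24 h14 h12 hnonneg hpos
  have v0' := v0
  have v1' := v1
  have v3' := v3
  simp only [volterra3, Matrix.cons_val] at v0' v1' v3' h2
  have w0 : 0 < w 0 := (hw 0).lt_of_ne' fun h => by simp [h] at v0'
  have w1 : 0 < w 1 := (hw 1).lt_of_ne' fun h => by simp [h] at v1'
  have w3 : 0 < w 3 := (hw 3).lt_of_ne' fun h => by simp [h] at v3'
  have f0 := pos_of_mul_pos_right v0' w0.le
  have f1 := pos_of_mul_pos_right v1' w1.le
  have f3 := pos_of_mul_pos_right v3' w3.le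
  have w2 : w 2 = 0 := by
    by_contra hne
    have h2' : 1 + (-a13 * w 0 + -a23 * w 1 + a34 * w 3) = 0 :=
      (mul_eq_zero.mp h2).resolve_left hne
    nlinarith [hw 2, hw 3, (hw 2).lt_of_ne' hne]
  refine ⟨w2, ?_⟩
  rw [← Real.log_lt_log_iff hpos (faceLyapunov_pos w0 w1 w3), log_faceLyapunov v0 v1 v3,
    log_faceLyapunov w0 w1 w3]
  simp only [volterra3, Matrix.cons_val]
  rw [Real.log_mul w0.ne' f0.ne', Real.log_mul w1.ne' f1.ne', Real.log_mul w3.ne' f3.ne']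
  have := weighted_log_sum_neg h24 h14 h12 f0 f1 f3 (by rw [w2]; ring) ?_
  · linarith
  rintro ⟨e0, e1, e3⟩
  rw [w2] at e0 e1 e3 hsum
  refine hwq (funext fun i => ?_)
  rw [eq_div_iff (by positivity)]
  fin_cases i <;> simp only [Fin.reduceFinMk, Fin.zero_eta, Fin.mk_one, Matrix.cons_val]
  · linear_combination a24 * hsum + e3 - e1
  · linear_combination a14 * hsum - e3 + e0
  · rw [w2, zero_mul]
  · linear_combination a12 * hsum - e0 + e1

/-- If `x` is interior, `min{(Vⁿx)₁,(Vⁿx)₃,(Vⁿx)₄} → 0`, and neither face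
fixed point `p`, `q` lies in `ω(x)`, then `ω(x) ⊆ {y : y₁y₂y₄ = 0 ∧ y₁y₃y₄ = 0}`. -/
theorem stmt_12 (a12 a13 a14 a23 a24 a34 : ℝ)
    (h12 : a12 ∈ Set.Ioo (0 : ℝ) 1) (h13 : a13 ∈ Set.Ioo (0 : ℝ) 1)
    (h14 : a14 ∈ Set.Ioo (0 : ℝ) 1) (h23 : a23 ∈ Set.Ioo (0 : ℝ) 1)
    (h24 : a24 ∈ Set.Ioo (0 : ℝ) 1) (h34 : a34 ∈ Set.Ioo (0 : ℝ) 1)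
    (V : (Fin 4 → ℝ) → (Fin 4 → ℝ)) (hV : V = volterra3 a12 a13 a14 a23 a24 a34)
    (p q : Fin 4 → ℝ)
    (hp : p = fun i => ![a34, 0, a14, a13] i / (a34 + a14 + a13))
    (hq : q = fun i => ![a24, a14, 0, a12] i / (a24 + a14 + a12))
    (x : Fin 4 → ℝ) (hx : x ∈ simplex3) (hxpos : ∀ i, 0 < x i)
    (hmin : Filter.Tendsto
      (fun n : ℕ => min (V^[n] x 0) (min (V^[n] x 2) (V^[n] x 3)))
      Filter.atTop (nhds 0))
    (hpω : p ∉ omegaSet V x) (hqω : q ∉ omegaSet V x) :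
    omegaSet V x ⊆ {y | y 0 * y 1 * y 3 = 0 ∧ y 0 * y 2 * y 3 = 0} := by
  subst hV hq
  have horbit : ∀ n, (volterra3 a12 a13 a14 a23 a24 a34)^[n] x ∈ simplex3 := fun n =>
    Set.MapsTo.iterate
      (fun _ hz => volterra3_mem_simplex3 h12 h13 h14 h23 h24 h34 hz) n hx
  have hsub := omegaSet_subset isCompact_simplex3.isClosed horbit
  have hV := continuous_volterra3 a12 a13 a14 a23 a24 a34
  set V := volterra3 a12 a13 a14 a23 a24 a34
  have hface : ∀ y ∈ omegaSet V x, y 0 * y 2 * y 3 = 0 := by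
    rintro y ⟨n, hn, hy⟩
    have hmin' : Continuous fun z : Fin 4 → ℝ => min (z 0) (min (z 2) (z 3)) := by fun_prop
    have h := tendsto_nhds_unique ((hmin'.tendsto y).comp hy) (hmin.comp hn)
    rcases min_choice (y 0) (min (y 2) (y 3)) with h' | h'
    · simp [h'.symm.trans h]
    · rcases min_choice (y 2) (y 3) with h'' | h'' <;> simp [h''.symm.trans (h'.symm.trans h)]
  intro y hy
  refine ⟨?_, hface y hy⟩
  by_contra hne
  simp only [mul_eq_zero, not_or] at hne
  obtain ⟨⟨y0, y1⟩, y3⟩ := hne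
  have y2 : y 2 = 0 := by simpa [y0, y3] using hface y hy
  have hyn := (hsub hy).1
  have hφy : 0 < faceLyapunov a24 a14 a12 y :=
    faceLyapunov_pos ((hyn 0).lt_of_ne' y0) ((hyn 1).lt_of_ne' y1) ((hyn 3).lt_of_ne' y3)
  have hK : IsCompact (omegaSet V x ∩ {z | z 2 = 0}) :=
    (isCompact_simplex3.of_isClosed_subset isClosed_omegaSet hsub).inter_right
      (isClosed_eq (continuous_apply 2) continuous_const)
  obtain ⟨z, ⟨hz, z2⟩, hmax⟩ := hK.exists_isMaxOn ⟨y, hy, y2⟩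
    (continuous_faceLyapunov h24.1 h14.1 h12.1).continuousOn
  obtain ⟨w, hw, rfl⟩ := exists_preimage_mem_omegaSet hV isCompact_simplex3 horbit hz
  obtain ⟨w2, hlt⟩ := faceLyapunov_volterra3_lt h12.1 h13.2 h14.1 h23.2 h24.1 h34.1 (hsub hw)
    (fun h => hqω (h ▸ hw)) z2 (hφy.trans_le (hmax ⟨hy, y2⟩)) (hsub hz).1
  exact (hmax ⟨hw, w2⟩).not_gt hlt
end
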